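/- Let ν be a Borel probability measure supported in (0,1]^d with L^q-spectrum β_ν, and suppose D̄_r(ν) > 0 for some r > 0. Then with q_r := D̄_r(ν)/(D̄_r(ν) + r) ∈ (0,1) one has β_ν(q_r) = r·q_r, i.e., β_ν(D̄_r(ν)/(D̄_r(ν)+r)) = r·D̄_r(ν)/(D̄_r(ν)+r). -/

import Mathlib

open MeasureTheory Filter

/-- The half-open dyadic cube of generation `n` indexed by `k ∈ ℤ^d`. -/
def dyadicCube (d n : ℕ) (k : Fin d → ℤ) : Set (EuclideanSpace ℝ (Fin d)) :=
  {x | ∀ i, (k i : ℝ) * 2 ^ (-(n : ℤ)) < x i ∧ x i ≤ ((k i : ℝ) + 1) * 2 ^ (-(n : ℤ))}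

/-- `Σ_{C ∈ D_n} ν(C)^q`, with the convention `0^0 = 0` (cubes of measure zero
are discarded). -/
noncomputable def lqSum {d : ℕ} (ν : Measure (EuclideanSpace ℝ (Fin d)))
    (n : ℕ) (q : ℝ) : ℝ :=
  ∑' k : Fin d → ℤ,
    if ν (dyadicCube d n k) = 0 then 0 else (ν (dyadicCube d n k)).toReal ^ q

/-- The `n`-th approximation `β_{ν,n}(q) = log (Σ_{C ∈ D_n} ν(C)^q) / log 2^n`. -/
noncomputable def lqSpectrumN {d : ℕ} (ν : Measure (EuclideanSpace ℝ (Fin d)))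
    (n : ℕ) (q : ℝ) : ℝ :=
  Real.log (lqSum ν n q) / (n * Real.log 2)

/-- The `L^q`-spectrum `β_ν(q) = limsup_n β_{ν,n}(q)`. -/
noncomputable def lqSpectrum {d : ℕ} (ν : Measure (EuclideanSpace ℝ (Fin d)))
    (q : ℝ) : ℝ :=
  Filter.limsup (fun n : ℕ => lqSpectrumN ν n q) Filter.atTop

open Metric in
/-- The `n`-th quantization error of order `r`. -/
noncomputable def quantError {d : ℕ} (ν : Measure (EuclideanSpace ℝ (Fin d)))
    (n : ℕ) (r : ℝ) : ℝ :=
  sInf ((fun α : Finset (EuclideanSpace ℝ (Fin d)) =>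
      (∫ x, infDist x (α : Set (EuclideanSpace ℝ (Fin d))) ^ r ∂ν) ^ (1 / r)) ''
    {α : Finset (EuclideanSpace ℝ (Fin d)) | α.Nonempty ∧ α.card ≤ n})

/-- The upper quantization dimension `D̄_r(ν) = limsup_n log n / (- log e_{n,r}(ν))`. -/
noncomputable def upperQDim {d : ℕ} (ν : Measure (EuclideanSpace ℝ (Fin d)))
    (r : ℝ) : ℝ :=
  Filter.limsup (fun n : ℕ => Real.log n / (- Real.log (quantError ν n r))) Filter.atTop

/-- The lower quantization dimension `D̲_r(ν) = liminf_n log n / (- log e_{n,r}(ν))`. -/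
noncomputable def lowerQDim {d : ℕ} (ν : Measure (EuclideanSpace ℝ (Fin d)))
    (r : ℝ) : ℝ :=
  Filter.liminf (fun n : ℕ => Real.log n / (- Real.log (quantError ν n r))) Filter.atTop

open Topology

/-- The index of the dyadic cube of generation `n` containing `x`. -/
noncomputable def cubeIndex {d : ℕ} (n : ℕ) (x : EuclideanSpace ℝ (Fin d)) : Fin d → ℤ :=
  fun i => ⌈x i * 2 ^ n⌉ - 1

/-- The indices of the dyadic cubes of generation `n` contained in `(0,1]^d`. -/
noncomputable def unitIndices (d n : ℕ) : Finset (Fin d → ℤ) :=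
  Fintype.piFinset fun _ => Finset.Ico 0 (2 ^ n)

/-- The corner of a dyadic cube that belongs to it. -/
noncomputable def cubeCorner {d : ℕ} (n : ℕ) (k : Fin d → ℤ) : EuclideanSpace ℝ (Fin d) :=
  WithLp.toLp 2 fun i => ((k i : ℝ) + 1) * 2 ^ (-(n : ℤ))

section Geometry

variable {d : ℕ}

lemma mem_dyadicCube_iff {n : ℕ} {k : Fin d → ℤ} {x : EuclideanSpace ℝ (Fin d)} :
    x ∈ dyadicCube d n k ↔ cubeIndex n x = k := by
  have h2 : (0 : ℝ) < 2 ^ n := by positivity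
  simp only [dyadicCube, Set.mem_ofPred_eq, funext_iff, cubeIndex, zpow_neg, zpow_natCast,
    ← div_eq_mul_inv, div_lt_iff₀ h2, le_div_iff₀ h2]
  refine forall_congr' fun i => ?_
  rw [sub_eq_iff_eq_add, Int.ceil_eq_iff]
  push_cast
  simp

lemma cubeIndex_mem_unitIndices (n : ℕ) {x : EuclideanSpace ℝ (Fin d)}
    (hx : ∀ i, x i ∈ Set.Ioc (0 : ℝ) 1) : cubeIndex n x ∈ unitIndices d n := by
  have h2 : (0 : ℝ) < 2 ^ n := by positivity
  simp only [unitIndices, Fintype.mem_piFinset, Finset.mem_Ico, cubeIndex]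
  intro i
  have h1 : 0 < ⌈x i * 2 ^ n⌉ := Int.ceil_pos.2 (mul_pos (hx i).1 h2)
  have h3 : ⌈x i * 2 ^ n⌉ ≤ 2 ^ n := by
    rw [Int.ceil_le]
    push_cast
    nlinarith [(hx i).2]
  omega

lemma card_unitIndices (d n : ℕ) : (unitIndices d n).card = (2 ^ n) ^ d := by
  have : ((2 : ℤ) ^ n).toNat = 2 ^ n := by
    rw [show (2 : ℤ) ^ n = ((2 ^ n : ℕ) : ℤ) by push_cast; rfl, Int.toNat_natCast]
  simp [unitIndices, this]

lemma measurableSet_dyadicCube (n : ℕ) (k : Fin d → ℤ) : MeasurableSet (dyadicCube d n k) := by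
  rw [dyadicCube, Set.ofPred_forall]
  refine MeasurableSet.iInter fun i => ?_
  have : Measurable fun x : EuclideanSpace ℝ (Fin d) => x i := by fun_prop
  exact (measurableSet_lt measurable_const this).inter (measurableSet_le this measurable_const)

lemma cubeIndex_cubeCorner (n : ℕ) (k : Fin d → ℤ) : cubeIndex n (cubeCorner n k) = k := by
  rw [← mem_dyadicCube_iff]
  intro i
  simp only [cubeCorner]
  exact ⟨mul_lt_mul_of_pos_right (by linarith) (by positivity), le_rfl⟩

lemma dist_le_of_forall_abs_sub_le {x y : EuclideanSpace ℝ (Fin d)} {δ : ℝ} (hδ : 0 ≤ δ)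
    (h : ∀ i, |x i - y i| ≤ δ) : dist x y ≤ (d + 1) * δ := by
  rw [EuclideanSpace.dist_eq]
  refine Real.sqrt_le_iff.2 ⟨by positivity, ?_⟩
  calc ∑ i, dist (x i) (y i) ^ 2 ≤ ∑ _i : Fin d, δ ^ 2 := by
        refine Finset.sum_le_sum fun i _ => ?_
        rw [Real.dist_eq]
        exact pow_le_pow_left₀ (abs_nonneg _) (h i) 2
    _ = d * δ ^ 2 := by simp
    _ ≤ ((d + 1) * δ) ^ 2 := by
        have : (0 : ℝ) ≤ d := d.cast_nonneg
        nlinarith [sq_nonneg δ, mul_nonneg this (sq_nonneg δ),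
          mul_nonneg (mul_nonneg this this) (sq_nonneg δ)]

lemma dist_cubeCorner_le (n : ℕ) (x : EuclideanSpace ℝ (Fin d)) :
    dist x (cubeCorner n (cubeIndex n x)) ≤ (d + 1) * 2 ^ (-(n : ℤ)) := by
  refine dist_le_of_forall_abs_sub_le (by positivity) fun i => ?_
  obtain ⟨h1, h2⟩ := (mem_dyadicCube_iff (x := x)).2 rfl i
  simp only [cubeCorner]
  rw [abs_le]
  constructor <;> linarith

lemma abs_sub_le_dist (x y : EuclideanSpace ℝ (Fin d)) (i : Fin d) : |x i - y i| ≤ dist x y := by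
  rw [dist_eq_norm, ← Real.norm_eq_abs]
  exact PiLp.norm_apply_le (x - y) i

lemma cubeIndex_succ (n : ℕ) (x : EuclideanSpace ℝ (Fin d)) :
    ∃ e ∈ Fintype.piFinset fun _ : Fin d => ({0, 1} : Finset ℤ),
      cubeIndex (n + 1) x = fun i => 2 * cubeIndex n x i + e i := by
  refine ⟨fun i => cubeIndex (n + 1) x i - 2 * cubeIndex n x i, ?_, by ext i; ring⟩
  simp only [Fintype.mem_piFinset, Finset.mem_insert, Finset.mem_singleton, cubeIndex]
  intro i
  have h1 := Int.le_ceil (x i * 2 ^ n)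
  have h2 := Int.ceil_lt_add_one (x i * 2 ^ n)
  have h3 : ⌈x i * 2 ^ (n + 1)⌉ ≤ 2 * ⌈x i * 2 ^ n⌉ := by
    rw [Int.ceil_le]; push_cast; rw [pow_succ]; linarith
  have h4 : 2 * ⌈x i * 2 ^ n⌉ - 2 < ⌈x i * 2 ^ (n + 1)⌉ := by
    rw [Int.lt_ceil]; push_cast; rw [pow_succ]; linarith
  omega

lemma cubeIndex_sub_mem_of_dist_lt {n : ℕ} {x a : EuclideanSpace ℝ (Fin d)}
    (h : dist x a < 2 ^ (-(n : ℤ))) :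
    cubeIndex n x - cubeIndex n a ∈ Fintype.piFinset fun _ : Fin d => ({-1, 0, 1} : Finset ℤ) := by
  simp only [Fintype.mem_piFinset, Finset.mem_insert, Finset.mem_singleton, cubeIndex,
    Pi.sub_apply]
  intro i
  have h2 : (0 : ℝ) < 2 ^ n := by positivity
  have h0 := (abs_sub_le_dist x a i).trans_lt h
  rw [zpow_neg, zpow_natCast, ← one_div, lt_div_iff₀ h2, ← abs_of_pos h2, ← abs_mul,
    sub_mul, abs_lt] at h0
  have h3 : ⌈x i * 2 ^ n⌉ ≤ ⌈a i * 2 ^ n⌉ + 1 := by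
    rw [Int.ceil_le]; push_cast; linarith [Int.le_ceil (a i * 2 ^ n)]
  have h4 : ⌈a i * 2 ^ n⌉ ≤ ⌈x i * 2 ^ n⌉ + 1 := by
    rw [Int.ceil_le]; push_cast; linarith [Int.le_ceil (x i * 2 ^ n)]
  omega

end Geometry

section LqSum

variable {d : ℕ} {ν : Measure (EuclideanSpace ℝ (Fin d))}

lemma measure_dyadicCube_eq_zero (hν : ∀ᵐ x ∂ν, ∀ i, x i ∈ Set.Ioc (0 : ℝ) 1) {n : ℕ}
    {k : Fin d → ℤ} (hk : k ∉ unitIndices d n) : ν (dyadicCube d n k) = 0 := by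
  refine measure_mono_null (fun x hx => ?_) (ae_iff.1 hν)
  intro h
  refine hk ?_
  rw [← mem_dyadicCube_iff.1 hx]
  exact cubeIndex_mem_unitIndices n h

lemma lqSum_eq_sum (hν : ∀ᵐ x ∂ν, ∀ i, x i ∈ Set.Ioc (0 : ℝ) 1) (n : ℕ) {q : ℝ} (hq : q ≠ 0) :
    lqSum ν n q = ∑ k ∈ unitIndices d n, ν.real (dyadicCube d n k) ^ q := by
  rw [lqSum, tsum_eq_sum (s := unitIndices d n)
    fun k hk => if_pos (measure_dyadicCube_eq_zero hν hk)]
  refine Finset.sum_congr rfl fun k _ => ?_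
  split_ifs with h
  · simp [Measure.real, h, Real.zero_rpow hq]
  · rfl

lemma lqSum_convexComb_le (hν : ∀ᵐ x ∂ν, ∀ i, x i ∈ Set.Ioc (0 : ℝ) 1) (n : ℕ) {p q a b : ℝ}
    (hp : 0 < p) (hq : 0 < q) (ha : 0 < a) (hb : 0 < b) (hab : a + b = 1) :
    lqSum ν n (a * p + b * q) ≤ lqSum ν n p ^ a * lqSum ν n q ^ b := by
  rw [lqSum_eq_sum hν n (by positivity), lqSum_eq_sum hν n hp.ne', lqSum_eq_sum hν n hq.ne']
  have hconj : (1 / a).HolderConjugate (1 / b) := by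
    rw [Real.holderConjugate_iff]
    refine ⟨?_, by simpa using hab⟩
    rw [lt_div_iff₀ ha]; linarith
  have h := Real.inner_le_Lp_mul_Lq_of_nonneg (unitIndices d n) hconj
    (f := fun k => ν.real (dyadicCube d n k) ^ (a * p))
    (g := fun k => ν.real (dyadicCube d n k) ^ (b * q))
    (fun k _ => by positivity) (fun k _ => by positivity)
  simp only [one_div_one_div] at h
  have key : ∀ c s : ℝ, 0 < c → ∀ k, (ν.real (dyadicCube d n k) ^ (c * s)) ^ (1 / c) =
      ν.real (dyadicCube d n k) ^ s := fun c s hc k => by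
    rw [← Real.rpow_mul measureReal_nonneg]
    congr 1
    field_simp
  simp only [key a p ha, key b q hb] at h
  refine le_trans (le_of_eq (Finset.sum_congr rfl fun k _ => ?_)) h
  exact Real.rpow_add_of_nonneg measureReal_nonneg (by positivity) (by positivity)

variable [IsProbabilityMeasure ν]

lemma one_le_sum_measureReal (hν : ∀ᵐ x ∂ν, ∀ i, x i ∈ Set.Ioc (0 : ℝ) 1) (n : ℕ) :
    1 ≤ ∑ k ∈ unitIndices d n, ν.real (dyadicCube d n k) := by
  have h : ν.real (⋃ k ∈ unitIndices d n, dyadicCube d n k) = 1 := by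
    have : ν (⋃ k ∈ unitIndices d n, dyadicCube d n k) = 1 := by
      refine (prob_compl_eq_zero_iff (Finset.measurableSet_biUnion _
        fun k _ => measurableSet_dyadicCube n k)).1
          (measure_mono_null (fun x hx => ?_) (ae_iff.1 hν))
      intro h
      refine hx ?_
      exact Set.mem_biUnion (cubeIndex_mem_unitIndices n h) (mem_dyadicCube_iff.2 rfl)
    simp [Measure.real, this]
  rw [← h]
  exact measureReal_biUnion_finset_le _ _

lemma one_le_lqSum (hν : ∀ᵐ x ∂ν, ∀ i, x i ∈ Set.Ioc (0 : ℝ) 1) (n : ℕ) {q : ℝ} (hq : 0 < q)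
    (hq1 : q ≤ 1) : 1 ≤ lqSum ν n q := by
  rw [lqSum_eq_sum hν n hq.ne']
  refine (one_le_sum_measureReal hν n).trans (Finset.sum_le_sum fun k _ => ?_)
  exact Real.self_le_rpow_of_le_one measureReal_nonneg measureReal_le_one hq1

lemma lqSum_le (hν : ∀ᵐ x ∂ν, ∀ i, x i ∈ Set.Ioc (0 : ℝ) 1) (n : ℕ) {q : ℝ} (hq : 0 < q) :
    lqSum ν n q ≤ (2 ^ n) ^ d := by
  rw [lqSum_eq_sum hν n hq.ne']
  refine (Finset.sum_le_card_nsmul _ _ 1 fun k _ =>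
    Real.rpow_le_one measureReal_nonneg measureReal_le_one hq.le).trans ?_
  simp [card_unitIndices]

lemma lqSpectrumN_nonneg (hν : ∀ᵐ x ∂ν, ∀ i, x i ∈ Set.Ioc (0 : ℝ) 1) (n : ℕ) {q : ℝ}
    (hq : 0 < q) (hq1 : q ≤ 1) : 0 ≤ lqSpectrumN ν n q :=
  div_nonneg (Real.log_nonneg (one_le_lqSum hν n hq hq1)) (by positivity)

lemma lqSpectrumN_le (hν : ∀ᵐ x ∂ν, ∀ i, x i ∈ Set.Ioc (0 : ℝ) 1) (n : ℕ) {q : ℝ}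
    (hq : 0 < q) (hq1 : q ≤ 1) : lqSpectrumN ν n q ≤ d := by
  refine div_le_of_le_mul₀ (by positivity) (by positivity) ?_
  have h := Real.log_le_log (zero_lt_one.trans_le (one_le_lqSum hν n hq hq1)) (lqSum_le hν n hq)
  rw [Real.log_pow, Real.log_pow] at h
  exact h

lemma isBoundedUnder_le_lqSpectrumN (hν : ∀ᵐ x ∂ν, ∀ i, x i ∈ Set.Ioc (0 : ℝ) 1) {q : ℝ}
    (hq : 0 < q) (hq1 : q ≤ 1) :
    IsBoundedUnder (· ≤ ·) atTop fun n : ℕ => lqSpectrumN ν n q :=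
  isBoundedUnder_of ⟨d, fun n => lqSpectrumN_le hν n hq hq1⟩

lemma isCoboundedUnder_le_lqSpectrumN (hν : ∀ᵐ x ∂ν, ∀ i, x i ∈ Set.Ioc (0 : ℝ) 1) {q : ℝ}
    (hq : 0 < q) (hq1 : q ≤ 1) :
    IsCoboundedUnder (· ≤ ·) atTop fun n : ℕ => lqSpectrumN ν n q :=
  (isBoundedUnder_of (r := (· ≥ ·))
    ⟨0, fun n => lqSpectrumN_nonneg hν n hq hq1⟩).isCoboundedUnder_le

lemma lqSpectrumN_convexComb_le (hν : ∀ᵐ x ∂ν, ∀ i, x i ∈ Set.Ioc (0 : ℝ) 1) (n : ℕ)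
    {p q a b : ℝ} (hp : 0 < p) (hp1 : p ≤ 1) (hq : 0 < q) (hq1 : q ≤ 1) (ha : 0 < a) (hb : 0 < b)
    (hab : a + b = 1) :
    lqSpectrumN ν n (a * p + b * q) ≤ a * lqSpectrumN ν n p + b * lqSpectrumN ν n q := by
  have hP := zero_lt_one.trans_le (one_le_lqSum hν n hp hp1)
  have hQ := zero_lt_one.trans_le (one_le_lqSum hν n hq hq1)
  have hPQ := zero_lt_one.trans_le (one_le_lqSum hν n (q := a * p + b * q) (by positivity)
    (by nlinarith))
  have h := Real.log_le_log hPQ (lqSum_convexComb_le hν n hp hq ha hb hab)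
  rw [Real.log_mul (by positivity) (by positivity), Real.log_rpow hP, Real.log_rpow hQ] at h
  simp only [lqSpectrumN, ← mul_div_assoc, ← add_div]
  exact div_le_div_of_nonneg_right h (by positivity)

lemma convexOn_lqSpectrum (hν : ∀ᵐ x ∂ν, ∀ i, x i ∈ Set.Ioc (0 : ℝ) 1) :
    ConvexOn ℝ (Set.Ioo 0 1) (lqSpectrum ν) := by
  rw [convexOn_iff_forall_pos]
  refine ⟨convex_Ioo 0 1, fun p hp q hq a b ha hb hab => le_of_forall_pos_le_add fun ε hε => ?_⟩
  have hpq : a * p + b * q ∈ Set.Ioo (0 : ℝ) 1 := convex_Ioo 0 1 hp hq ha.le hb.le hab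
  have h1 := eventually_lt_of_limsup_lt (lt_add_of_pos_right (lqSpectrum ν p) hε)
    (isBoundedUnder_le_lqSpectrumN hν hp.1 hp.2.le)
  have h2 := eventually_lt_of_limsup_lt (lt_add_of_pos_right (lqSpectrum ν q) hε)
    (isBoundedUnder_le_lqSpectrumN hν hq.1 hq.2.le)
  refine limsup_le_of_le (isCoboundedUnder_le_lqSpectrumN hν hpq.1 hpq.2.le) ?_
  filter_upwards [h1, h2] with n h1 h2
  have := lqSpectrumN_convexComb_le hν n hp.1 hp.2.le hq.1 hq.2.le ha hb hab
  simp only [smul_eq_mul]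
  nlinarith

lemma continuousOn_lqSpectrum (hν : ∀ᵐ x ∂ν, ∀ i, x i ∈ Set.Ioc (0 : ℝ) 1) :
    ContinuousOn (lqSpectrum ν) (Set.Ioo 0 1) :=
  (convexOn_lqSpectrum hν).continuousOn isOpen_Ioo

lemma lqSum_le_of_lqSpectrumN_le (hν : ∀ᵐ x ∂ν, ∀ i, x i ∈ Set.Ioc (0 : ℝ) 1) {n : ℕ}
    (hn : 0 < n) {q s : ℝ} (hq : 0 < q) (hq1 : q ≤ 1) (h : lqSpectrumN ν n q ≤ s) :
    lqSum ν n q ≤ (2 : ℝ) ^ (s * n) := by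
  have hl := Real.log_pos one_lt_two
  rw [lqSpectrumN, div_le_iff₀ (by positivity)] at h
  rw [← Real.log_le_log_iff (zero_lt_one.trans_le (one_le_lqSum hν n hq hq1)) (by positivity),
    Real.log_rpow two_pos]
  linarith

lemma lqSpectrum_le_of_lqSum_le (hν : ∀ᵐ x ∂ν, ∀ i, x i ∈ Set.Ioc (0 : ℝ) 1) {q s K : ℝ}
    (hq : 0 < q) (hq1 : q ≤ 1) (hK : 0 < K) (h : ∀ n : ℕ, lqSum ν n q ≤ K * (2 : ℝ) ^ (s * n)) :
    lqSpectrum ν q ≤ s := by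
  have hl := Real.log_pos one_lt_two
  have hlim : Tendsto (fun n : ℕ => s + Real.log K / Real.log 2 / n) atTop (𝓝 s) := by
    simpa using (tendsto_const_nhds (x := s)).add
      (tendsto_const_div_atTop_nhds_zero_nat (Real.log K / Real.log 2))
  rw [← hlim.limsup_eq]
  refine limsup_le_limsup ?_ (isCoboundedUnder_le_lqSpectrumN hν hq hq1) hlim.isBoundedUnder_le
  filter_upwards [eventually_gt_atTop 0] with n hn
  have hn' : (0 : ℝ) < n := Nat.cast_pos.2 hn
  have := Real.log_le_log (zero_lt_one.trans_le (one_le_lqSum hν n hq hq1)) (h n)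
  rw [Real.log_mul hK.ne' (by positivity), Real.log_rpow two_pos] at this
  rw [lqSpectrumN, div_le_iff₀ (by positivity)]
  field_simp
  linarith

end LqSum

section QuantError

variable {d : ℕ} {ν : Measure (EuclideanSpace ℝ (Fin d))}

lemma integral_infDist_rpow_nonneg (s : Set (EuclideanSpace ℝ (Fin d))) (r : ℝ) :
    0 ≤ ∫ x, Metric.infDist x s ^ r ∂ν :=
  integral_nonneg fun _ => Real.rpow_nonneg Metric.infDist_nonneg r

lemma quantError_nonneg (n : ℕ) (r : ℝ) : 0 ≤ quantError ν n r := by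
  refine Real.sInf_nonneg ?_
  rintro _ ⟨α, -, rfl⟩
  exact Real.rpow_nonneg (integral_infDist_rpow_nonneg _ r) _

lemma quantError_le {n : ℕ} {r : ℝ} {α : Finset (EuclideanSpace ℝ (Fin d))} (hα : α.Nonempty)
    (hn : α.card ≤ n) :
    quantError ν n r ≤
      (∫ x, Metric.infDist x (α : Set (EuclideanSpace ℝ (Fin d))) ^ r ∂ν) ^ (1 / r) := by
  refine csInf_le ⟨0, ?_⟩ ⟨α, ⟨hα, hn⟩, rfl⟩
  rintro _ ⟨β, -, rfl⟩
  exact Real.rpow_nonneg (integral_infDist_rpow_nonneg _ r) _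

lemma le_quantError {n : ℕ} (hn : 0 < n) {r b : ℝ}
    (h : ∀ α : Finset (EuclideanSpace ℝ (Fin d)), α.Nonempty → α.card ≤ n →
      b ≤ (∫ x, Metric.infDist x (α : Set (EuclideanSpace ℝ (Fin d))) ^ r ∂ν) ^ (1 / r)) :
    b ≤ quantError ν n r := by
  refine le_csInf ⟨_, {0}, ⟨Finset.singleton_nonempty _, by simpa using Nat.succ_le_of_lt hn⟩,
    rfl⟩ ?_
  rintro _ ⟨α, ⟨hα, hα'⟩, rfl⟩
  exact h α hα hα'

lemma quantError_anti {m n : ℕ} (hm : 0 < m) (hmn : m ≤ n) (r : ℝ) :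
    quantError ν n r ≤ quantError ν m r :=
  le_quantError hm fun _ hα hα' => quantError_le hα (hα'.trans hmn)

/-- The cubes `C` of generation `n` with `ν(C) diam(C)^r ≥ t` (up to a constant). -/
noncomputable def heavyIndices (ν : Measure (EuclideanSpace ℝ (Fin d))) (r t : ℝ) (n : ℕ) :
    Finset (Fin d → ℤ) :=
  open Classical in
  (unitIndices d n).filter fun k => t ≤ ν.real (dyadicCube d n k) * (2 ^ (-(n : ℤ))) ^ r

lemma mem_heavyIndices {r t : ℝ} {n : ℕ} {k : Fin d → ℤ} :
    k ∈ heavyIndices ν r t n ↔ k ∈ unitIndices d n ∧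
      t ≤ ν.real (dyadicCube d n k) * (2 ^ (-(n : ℤ))) ^ r := by
  simp [heavyIndices]

lemma card_heavyIndices_le (hν : ∀ᵐ x ∂ν, ∀ i, x i ∈ Set.Ioc (0 : ℝ) 1) {r t q : ℝ} (ht : 0 < t)
    (hq : 0 < q) (n : ℕ) :
    ((heavyIndices ν r t n).card : ℝ) ≤
      t ^ (-q) * (((2 ^ (-(n : ℤ))) ^ r) ^ q * lqSum ν n q) := by
  have hδ : (0 : ℝ) < 2 ^ (-(n : ℤ)) := by positivity
  rw [lqSum_eq_sum hν n hq.ne', Real.rpow_neg ht.le, ← div_eq_inv_mul,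
    le_div_iff₀ (by positivity), Finset.mul_sum]
  calc ((heavyIndices ν r t n).card : ℝ) * t ^ q = ∑ k ∈ heavyIndices ν r t n, t ^ q := by simp
    _ ≤ ∑ k ∈ heavyIndices ν r t n,
          ((2 ^ (-(n : ℤ))) ^ r) ^ q * ν.real (dyadicCube d n k) ^ q := by
        refine Finset.sum_le_sum fun k hk => ?_
        rw [← Real.mul_rpow (by positivity) measureReal_nonneg, mul_comm _ (ν.real _)]
        exact Real.rpow_le_rpow ht.le (mem_heavyIndices.1 hk).2 hq.le
    _ ≤ _ := Finset.sum_le_sum_of_subset_of_nonneg (fun k hk => (mem_heavyIndices.1 hk).1)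
        fun k _ _ => by positivity

variable [IsProbabilityMeasure ν]

lemma integrable_infDist_rpow (hν : ∀ᵐ x ∂ν, ∀ i, x i ∈ Set.Ioc (0 : ℝ) 1) {r : ℝ} (hr : 0 < r)
    {s : Set (EuclideanSpace ℝ (Fin d))} (hs : s.Nonempty) :
    Integrable (fun x => Metric.infDist x s ^ r) ν := by
  obtain ⟨a, ha⟩ := hs
  refine Integrable.of_bound (C := ((d + 1) * 1 + dist 0 a) ^ r)
    (((Metric.continuous_infDist_pt s).rpow_const
      fun _ => Or.inr hr.le).aestronglyMeasurable) ?_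
  filter_upwards [hν] with x hx
  rw [Real.norm_of_nonneg (Real.rpow_nonneg Metric.infDist_nonneg r)]
  refine Real.rpow_le_rpow Metric.infDist_nonneg ?_ hr.le
  have h0 : dist x 0 ≤ (d + 1) * 1 := by
    refine dist_le_of_forall_abs_sub_le zero_le_one fun i => ?_
    rw [PiLp.zero_apply, sub_zero, abs_le]
    exact ⟨by linarith [(hx i).1], (hx i).2⟩
  linarith [Metric.infDist_le_dist_of_mem (x := x) ha, dist_triangle x 0 a]

/-- If there are many cubes of generation `n` with mass at least `c`, then few points cannot be
close to all of them. -/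
lemma mul_le_integral_infDist_rpow (hν : ∀ᵐ x ∂ν, ∀ i, x i ∈ Set.Ioc (0 : ℝ) 1) {r : ℝ}
    (hr : 0 < r) {n m : ℕ} {c : ℝ} (hc : 0 ≤ c) {S : Finset (Fin d → ℤ)}
    (hS : ∀ k ∈ S, c ≤ ν.real (dyadicCube d n k)) (hm : m * (3 ^ d + 1) ≤ S.card)
    {α : Finset (EuclideanSpace ℝ (Fin d))} (hα : α.Nonempty) (hαm : α.card ≤ m) :
    m * (c * (2 ^ (-(n : ℤ))) ^ r) ≤
      ∫ x, Metric.infDist x (α : Set (EuclideanSpace ℝ (Fin d))) ^ r ∂ν := by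
  classical
  set δ : ℝ := 2 ^ (-(n : ℤ)) with hδ
  have hδ0 : 0 < δ := by positivity
  set near : Finset (Fin d → ℤ) := (α ×ˢ Fintype.piFinset fun _ : Fin d =>
    ({-1, 0, 1} : Finset ℤ)).image fun z => cubeIndex n z.1 + z.2 with hnear
  have hcard : near.card ≤ m * 3 ^ d := by
    refine Finset.card_image_le.trans ?_
    rw [Finset.card_product, Fintype.card_piFinset]
    simpa using hαm
  have hfar : m ≤ (S \ near).card := by
    have := Finset.le_card_sdiff near S
    rw [mul_add, mul_one] at hm
    omega
  have hpt : ∀ x, (∑ k ∈ S \ near, (dyadicCube d n k).indicator (fun _ => δ ^ r) x) ≤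
      Metric.infDist x (α : Set (EuclideanSpace ℝ (Fin d))) ^ r := by
    intro x
    have h : ∀ k, (dyadicCube d n k).indicator (fun _ => δ ^ r) x =
        if cubeIndex n x = k then δ ^ r else 0 := fun k => by
      simp [Set.indicator_apply, mem_dyadicCube_iff]
    simp only [h, Finset.sum_ite_eq]
    split_ifs with hx
    · refine Real.rpow_le_rpow hδ0.le ((Metric.le_infDist (by simpa using hα)).2 fun a ha => ?_)
        hr.le
      by_contra! hlt
      refine (Finset.mem_sdiff.1 hx).2 (Finset.mem_image.2
        ⟨(a, cubeIndex n x - cubeIndex n a), Finset.mem_product.2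
          ⟨by simpa using ha, cubeIndex_sub_mem_of_dist_lt hlt⟩, by simp⟩)
    · exact Real.rpow_nonneg Metric.infDist_nonneg r
  have hint : ∀ k ∈ S \ near,
      Integrable ((dyadicCube d n k).indicator fun _ => δ ^ r) ν := fun k _ =>
    (integrable_const _).indicator (measurableSet_dyadicCube n k)
  calc m * (c * δ ^ r) ≤ (S \ near).card * (c * δ ^ r) := by gcongr
    _ = ∑ k ∈ S \ near, c * δ ^ r := by simp
    _ ≤ ∑ k ∈ S \ near, ν.real (dyadicCube d n k) * δ ^ r := by
        refine Finset.sum_le_sum fun k hk => ?_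
        gcongr
        exact hS k (Finset.mem_sdiff.1 hk).1
    _ = ∫ x, ∑ k ∈ S \ near, (dyadicCube d n k).indicator (fun _ => δ ^ r) x ∂ν := by
        rw [integral_finsetSum _ hint]
        refine Finset.sum_congr rfl fun k _ => ?_
        rw [integral_indicator_const _ (measurableSet_dyadicCube n k), smul_eq_mul]
    _ ≤ _ := integral_mono (integrable_finsetSum _ hint)
        (integrable_infDist_rpow hν hr (by simpa using hα)) hpt

lemma zero_mem_heavyIndices_zero (hν : ∀ᵐ x ∂ν, ∀ i, x i ∈ Set.Ioc (0 : ℝ) 1) {r t : ℝ}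
    (ht : t ≤ 1) : 0 ∈ heavyIndices ν r t 0 := by
  have h0 : unitIndices d 0 = {0} := by
    ext k
    simp only [unitIndices, Fintype.mem_piFinset, Finset.mem_Ico, Finset.mem_singleton, pow_zero,
      funext_iff, Pi.zero_apply]
    exact forall_congr' fun i => by omega
  have h1 := one_le_sum_measureReal hν 0
  rw [h0, Finset.sum_singleton] at h1
  rw [mem_heavyIndices, h0]
  simpa using ht.trans h1

lemma exists_heavyIndices_eq_empty {r t : ℝ} (hr : 0 < r) (ht : 0 < t) :
    ∃ L, ∀ n, L ≤ n → heavyIndices ν r t n = ∅ := by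
  have hlim : Tendsto (fun n : ℕ => ((2 : ℝ) ^ (-(n : ℤ))) ^ r) atTop (𝓝 0) := by
    have h1 : Tendsto (fun n : ℕ => (2 : ℝ) ^ (-(n : ℤ))) atTop (𝓝 0) := by
      simpa using tendsto_pow_atTop_nhds_zero_of_lt_one (r := (2 : ℝ)⁻¹) (by norm_num)
        (by norm_num)
    have := h1.rpow_const (p := r) (Or.inr hr.le)
    rwa [Real.zero_rpow hr.ne'] at this
  obtain ⟨L, hL⟩ := eventually_atTop.1 (hlim.eventually (gt_mem_nhds ht))
  refine ⟨L, fun n hn => Finset.eq_empty_of_forall_notMem fun k hk => ?_⟩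
  have h1 := (mem_heavyIndices.1 hk).2
  have h2 : ν.real (dyadicCube d n k) ≤ 1 := measureReal_le_one
  have h3 := hL n hn
  have h4 : (0 : ℝ) < (2 ^ (-(n : ℤ))) ^ r := by positivity
  nlinarith

/-- The corners of the heavy cubes form a good quantizing set. -/
lemma exists_integral_infDist_rpow_le (hν : ∀ᵐ x ∂ν, ∀ i, x i ∈ Set.Ioc (0 : ℝ) 1) {r t N : ℝ}
    (hr : 0 < r) (ht : 0 < t) (ht1 : t ≤ 1)
    (hN : ∀ L, ∑ n ∈ Finset.range L, ((heavyIndices ν r t n).card : ℝ) ≤ N) :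
    ∃ α : Finset (EuclideanSpace ℝ (Fin d)), α.Nonempty ∧ (α.card : ℝ) ≤ N ∧
      ∫ x, Metric.infDist x (α : Set (EuclideanSpace ℝ (Fin d))) ^ r ∂ν ≤
        N * (2 ^ d * ((d + 1) ^ r * 2 ^ r * t)) := by
  classical
  obtain ⟨L, hL⟩ := exists_heavyIndices_eq_empty (ν := ν) hr ht
  set δ : ℕ → ℝ := fun n => 2 ^ (-(n : ℤ)) with hδ
  have hδ0 : ∀ n, 0 < δ n := fun n => by positivity
  have hδs : ∀ n, δ n = 2 * δ (n + 1) := fun n => by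
    simp only [hδ, zpow_neg, zpow_natCast, pow_succ]
    field_simp
  set G := (Finset.range L).sigma fun n => heavyIndices ν r t n with hG
  set E := Fintype.piFinset fun _ : Fin d => ({0, 1} : Finset ℤ) with hE
  set child : (Σ _ : ℕ, Fin d → ℤ) → (Fin d → ℤ) → Fin d → ℤ :=
    fun z e i => 2 * z.2 i + e i with hchild
  have hEcard : E.card = 2 ^ d := by
    rw [hE, Fintype.card_piFinset]
    simp
  have hGcard : (G.card : ℝ) ≤ N := by
    rw [hG, Finset.card_sigma]
    push_cast
    exact hN L
  have hmemG : ∀ {n k}, k ∈ heavyIndices ν r t n → (⟨n, k⟩ : Σ _ : ℕ, Fin d → ℤ) ∈ G := by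
    intro n k hk
    refine Finset.mem_sigma.2 ⟨Finset.mem_range.2 ?_, hk⟩
    by_contra! h
    rw [hL n h] at hk
    simp at hk
  set α : Finset (EuclideanSpace ℝ (Fin d)) := G.image fun z => cubeCorner z.1 z.2 with hα
  set F : (Σ _ : ℕ, Fin d → ℤ) → (Fin d → ℤ) → EuclideanSpace ℝ (Fin d) → ℝ := fun z e =>
    if child z e ∈ heavyIndices ν r t (z.1 + 1) then 0
    else (dyadicCube d (z.1 + 1) (child z e)).indicator fun _ => ((d + 1) * δ z.1) ^ r with hF
  have hF0 : ∀ z e x, 0 ≤ F z e x := by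
    intro z e x
    simp only [hF]
    split_ifs
    · exact le_rfl
    · exact Set.indicator_nonneg (fun _ _ => by positivity) x
  have hFint : ∀ z e, Integrable (F z e) ν := by
    intro z e
    simp only [hF]
    split_ifs
    · exact integrable_zero _ _ _
    · exact (integrable_const _).indicator (measurableSet_dyadicCube _ _)
  have hFle : ∀ z e, ∫ x, F z e x ∂ν ≤ (d + 1) ^ r * 2 ^ r * t := by
    intro z e
    simp only [hF]
    split_ifs with h
    · simp only [Pi.zero_apply, integral_zero]
      positivity
    · rw [integral_indicator_const _ (measurableSet_dyadicCube _ _), smul_eq_mul, hδs,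
        Real.mul_rpow (by positivity) (by positivity),
        Real.mul_rpow (by positivity) (hδ0 _).le]
      have hlight : ν.real (dyadicCube d (z.1 + 1) (child z e)) * δ (z.1 + 1) ^ r ≤ t := by
        by_cases hu : child z e ∈ unitIndices d (z.1 + 1)
        · by_contra! hlt
          exact h (mem_heavyIndices.2 ⟨hu, hlt.le⟩)
        · rw [Measure.real, measure_dyadicCube_eq_zero hν hu]
          simpa using ht.le
      calc _ = (d + 1) ^ r * 2 ^ r *
            (ν.real (dyadicCube d (z.1 + 1) (child z e)) * δ (z.1 + 1) ^ r) := by ring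
        _ ≤ _ := by gcongr
  have hpt : ∀ x : EuclideanSpace ℝ (Fin d), (∀ i, x i ∈ Set.Ioc (0 : ℝ) 1) →
      Metric.infDist x (α : Set (EuclideanSpace ℝ (Fin d))) ^ r ≤
        ∑ z ∈ G, ∑ e ∈ E, F z e x := by
    intro x hx
    have hex : ∃ n, cubeIndex (n + 1) x ∉ heavyIndices ν r t (n + 1) :=
      ⟨L, by rw [hL _ (Nat.le_succ L)]; simp⟩
    obtain ⟨n, hn, hmin⟩ : ∃ n, cubeIndex (n + 1) x ∉ heavyIndices ν r t (n + 1) ∧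
        cubeIndex n x ∈ heavyIndices ν r t n := by
      refine ⟨Nat.find hex, Nat.find_spec hex, ?_⟩
      rcases h : Nat.find hex with _ | m
      · have h0 : cubeIndex 0 x = 0 := by
          have := cubeIndex_mem_unitIndices 0 hx
          ext i
          have := Finset.mem_Ico.1 (Fintype.mem_piFinset.1 this i)
          simp only [pow_zero] at this
          simp only [Pi.zero_apply]
          omega
        rw [h0]
        exact zero_mem_heavyIndices_zero hν ht1
      · exact not_not.1 (Nat.find_min hex (m := m) (by omega))
    obtain ⟨e, he, hce⟩ := cubeIndex_succ n x
    have hz := hmemG hmin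
    calc Metric.infDist x (α : Set (EuclideanSpace ℝ (Fin d))) ^ r
        ≤ ((d + 1) * δ n) ^ r := by
          refine Real.rpow_le_rpow Metric.infDist_nonneg ?_ hr.le
          exact (Metric.infDist_le_dist_of_mem (by
            exact_mod_cast Finset.mem_image_of_mem _ hz)).trans (dist_cubeCorner_le n x)
      _ = F ⟨n, cubeIndex n x⟩ e x := by
          have hc : child ⟨n, cubeIndex n x⟩ e = cubeIndex (n + 1) x := hce.symm
          simp only [hF, hc, if_neg hn]
          rw [Set.indicator_of_mem (mem_dyadicCube_iff.2 rfl)]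
      _ ≤ ∑ e ∈ E, F ⟨n, cubeIndex n x⟩ e x :=
          Finset.single_le_sum (f := fun e => F ⟨n, cubeIndex n x⟩ e x)
            (fun e _ => hF0 _ e x) he
      _ ≤ _ := Finset.single_le_sum (f := fun z => ∑ e ∈ E, F z e x)
            (fun z _ => Finset.sum_nonneg fun e _ => hF0 z e x) hz
  refine ⟨α, ⟨_, Finset.mem_image_of_mem _ (hmemG (zero_mem_heavyIndices_zero hν ht1))⟩,
    le_trans (by exact_mod_cast Finset.card_image_le) hGcard, ?_⟩
  calc ∫ x, Metric.infDist x (α : Set (EuclideanSpace ℝ (Fin d))) ^ r ∂ν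
      ≤ ∫ x, ∑ z ∈ G, ∑ e ∈ E, F z e x ∂ν := by
        refine integral_mono_of_nonneg
          (.of_forall fun x => Real.rpow_nonneg Metric.infDist_nonneg r)
          (integrable_finsetSum _ fun z _ => integrable_finsetSum _ fun e _ => hFint z e) ?_
        filter_upwards [hν] with x hx using hpt x hx
    _ = ∑ z ∈ G, ∑ e ∈ E, ∫ x, F z e x ∂ν := by
        rw [integral_finsetSum _ fun z _ => integrable_finsetSum _ fun e _ => hFint z e]
        exact Finset.sum_congr rfl fun z _ => integral_finsetSum _ fun e _ => hFint z e
    _ ≤ ∑ z ∈ G, ∑ e ∈ E, (d + 1) ^ r * 2 ^ r * t :=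
        Finset.sum_le_sum fun z _ => Finset.sum_le_sum fun e _ => hFle z e
    _ = G.card * (2 ^ d * ((d + 1) ^ r * 2 ^ r * t)) := by simp [hEcard]
    _ ≤ _ := by gcongr

end QuantError

section Dimension

variable {d : ℕ} {ν : Measure (EuclideanSpace ℝ (Fin d))}

lemma upperQDim_le_one_div {r a C : ℝ} (ha : 0 < a) (hC : 0 < C)
    (h : ∀ᶠ n : ℕ in atTop, quantError ν n r ≤ C * (n : ℝ) ^ (-a)) : upperQDim ν r ≤ 1 / a := by
  have hlog : Tendsto (fun n : ℕ => Real.log n) atTop atTop :=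
    Real.tendsto_log_atTop.comp tendsto_natCast_atTop_atTop
  have hlim : Tendsto (fun n : ℕ => 1 / (a - Real.log C / Real.log n)) atTop (𝓝 (1 / a)) := by
    have := (tendsto_const_nhds (x := a)).sub
      ((tendsto_const_nhds (x := Real.log C)).div_atTop hlog)
    rw [sub_zero] at this
    exact tendsto_const_nhds.div this ha.ne'
  have hbound : ∀ᶠ n : ℕ in atTop, 0 ≤ Real.log n / (-Real.log (quantError ν n r)) ∧
      Real.log n / (-Real.log (quantError ν n r)) ≤ 1 / (a - Real.log C / Real.log n) := by
    filter_upwards [h, hlog.eventually_gt_atTop 0, hlog.eventually_gt_atTop (Real.log C / a),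
      eventually_gt_atTop 0] with n hn h0 h1 hn0
    have hn0' : (0 : ℝ) < n := Nat.cast_pos.2 hn0
    rw [div_lt_iff₀ ha] at h1
    have h2 : 0 < a - Real.log C / Real.log n := by
      rw [sub_pos, div_lt_iff₀ h0]
      linarith
    rcases (quantError_nonneg (ν := ν) n r).eq_or_lt with h3 | h3
    · rw [← h3]
      simpa using h2.le
    · have h4 := Real.log_le_log h3 hn
      rw [Real.log_mul hC.ne' (by positivity), Real.log_rpow hn0'] at h4
      have h5 : 0 < -Real.log (quantError ν n r) := by linarith
      refine ⟨by positivity, ?_⟩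
      rw [div_le_div_iff₀ h5 h2]
      have : Real.log n * (a - Real.log C / Real.log n) = a * Real.log n - Real.log C := by
        field_simp
      linarith
  rw [← hlim.limsup_eq]
  exact limsup_le_limsup (hbound.mono fun n hn => hn.2)
    (isBoundedUnder_of_eventually_ge (hbound.mono fun n hn => hn.1)).isCoboundedUnder_le
    hlim.isBoundedUnder_le

lemma exists_quantError_lt_one {r : ℝ} (h : 0 < upperQDim ν r) :
    ∃ m, 0 < m ∧ quantError ν m r < 1 := by
  by_contra! hne
  refine h.not_ge ?_
  have h0 : ∀ᶠ n : ℕ in atTop, Real.log n / (-Real.log (quantError ν n r)) ≤ 0 := by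
    filter_upwards [eventually_gt_atTop 0] with n hn
    exact div_nonpos_of_nonneg_of_nonpos (Real.log_natCast_nonneg n)
      (neg_nonpos.2 (Real.log_nonneg (hne n hn)))
  rw [upperQDim, limsup_eq]
  by_cases hb : BddBelow {a | ∀ᶠ n : ℕ in atTop,
      Real.log n / (-Real.log (quantError ν n r)) ≤ a}
  · exact csInf_le hb h0
  · exact (Real.sInf_of_not_bddBelow hb).le

lemma eventually_quantError_le {r D : ℝ} (h : 0 < upperQDim ν r) (hD : upperQDim ν r < D) :
    ∀ᶠ n : ℕ in atTop, quantError ν n r ≤ (n : ℝ) ^ (-(1 / D)) := by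
  obtain ⟨m, hm, hm1⟩ := exists_quantError_lt_one h
  have hD0 := h.trans hD
  have hb : IsBoundedUnder (· ≤ ·) atTop
      fun n : ℕ => Real.log n / (-Real.log (quantError ν n r)) := by
    by_contra hb
    refine h.ne' ?_
    have : {a | ∀ᶠ n : ℕ in atTop, Real.log n / (-Real.log (quantError ν n r)) ≤ a} = ∅ :=
      Set.eq_empty_of_forall_notMem fun a ha => hb (isBoundedUnder_of_eventually_le ha)
    rw [upperQDim, limsup_eq, this, Real.sInf_empty]
  filter_upwards [eventually_lt_of_limsup_lt hD hb, eventually_ge_atTop m] with n hn hmn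
  have hn0 : (0 : ℝ) < n := Nat.cast_pos.2 (hm.trans_le hmn)
  rcases (quantError_nonneg (ν := ν) n r).eq_or_lt with h3 | h3
  · rw [← h3]
    positivity
  · have h4 := Real.log_neg h3 ((quantError_anti hm hmn r).trans_lt hm1)
    rw [div_lt_iff₀ (by linarith)] at hn
    rw [← Real.log_le_log_iff h3 (by positivity), Real.log_rpow hn0, neg_mul, le_neg,
      one_div_mul_eq_div, div_le_iff₀ hD0]
    linarith

/-- A weak-type bound on the distribution of a finite family gives a strong-type bound. -/
lemma sum_rpow_le_of_card_filter_le {ι : Type*} {I : Finset ι} {f : ι → ℝ} {A p q : ℝ}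
    (hp : 0 < p) (hpq : p < q) (hf0 : ∀ k, 0 ≤ f k) (hf1 : ∀ k, f k ≤ 1)
    (h : ∀ c, 0 < c → c ≤ 1 → ∀ S ⊆ I, (∀ k ∈ S, c ≤ f k) → (S.card : ℝ) ≤ A * c ^ (-p)) :
    ∑ k ∈ I, f k ^ q ≤ A * (2 ^ p * (1 - 2 ^ (p - q))⁻¹) := by
  classical
  have hq : 0 < q := hp.trans hpq
  set y : ℝ := 1 / 2 with hy
  have hyj : ∀ j : ℕ, 0 < y ^ j := fun j => by positivity
  set g : ι → ℕ → ℝ := fun k j => if y ^ (j + 1) ≤ f k then (y ^ j) ^ q else 0 with hg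
  have hg0 : ∀ k j, 0 ≤ g k j := fun k j => by
    simp only [hg]
    split_ifs <;> positivity
  have hgeo : ∀ s : ℝ, ∀ j : ℕ, (y ^ j) ^ s = (y ^ s) ^ j := fun s j => by
    rw [← Real.rpow_natCast_mul (by positivity), mul_comm, Real.rpow_mul_natCast (by positivity)]
  have hsum : ∀ k, Summable (g k) := fun k => by
    refine Summable.of_nonneg_of_le (hg0 k) (fun j => ?_) (summable_geometric_of_lt_one
      (r := y ^ q) (by positivity) (Real.rpow_lt_one (by positivity) (by norm_num [hy]) hq))
    rw [← hgeo]
    simp only [hg]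
    split_ifs
    · exact le_rfl
    · positivity
  have hρ : (2 : ℝ) ^ (p - q) < 1 := Real.rpow_lt_one_of_one_lt_of_neg one_lt_two (by linarith)
  have hle : ∀ k, f k ^ q ≤ ∑' j, g k j := by
    intro k
    rcases (hf0 k).eq_or_lt with h0 | h0
    · rw [← h0, Real.zero_rpow hq.ne']
      exact tsum_nonneg (hg0 k)
    · obtain ⟨j, hj1, hj2⟩ := exists_nat_pow_near_of_lt_one h0 (hf1 k)
        (show 0 < y by positivity) (by norm_num [hy])
      calc f k ^ q ≤ (y ^ j) ^ q := Real.rpow_le_rpow h0.le hj2 hq.le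
        _ = g k j := by simp only [hg, if_pos hj1.le]
        _ ≤ _ := (hsum k).le_tsum j fun i _ => hg0 k i
  have hcol : ∀ j, ∑ k ∈ I, g k j ≤ A * 2 ^ p * (2 ^ (p - q)) ^ j := by
    intro j
    simp only [hg]
    rw [← Finset.sum_filter, Finset.sum_const, nsmul_eq_mul]
    have h1 := h (y ^ (j + 1)) (hyj _) (pow_le_one₀ (by positivity) (by norm_num [hy]))
      (I.filter fun k => y ^ (j + 1) ≤ f k) (Finset.filter_subset _ _)
      (fun k hk => (Finset.mem_filter.1 hk).2)
    calc _ ≤ A * (y ^ (j + 1)) ^ (-p) * (y ^ j) ^ q := by gcongr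
      _ = A * 2 ^ p * (2 ^ (p - q)) ^ j := by
        have e1 : ∀ s : ℝ, y ^ s = 2 ^ (-s) := fun s => by
          rw [hy, one_div, Real.inv_rpow two_pos.le, Real.rpow_neg two_pos.le]
        rw [hgeo, hgeo, e1, e1, neg_neg, pow_succ, sub_eq_add_neg, Real.rpow_add two_pos, mul_pow]
        ring
  calc ∑ k ∈ I, f k ^ q ≤ ∑ k ∈ I, ∑' j, g k j := Finset.sum_le_sum fun k _ => hle k
    _ = ∑' j, ∑ k ∈ I, g k j := (Summable.tsum_finsetSum fun k _ => hsum k).symm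
    _ ≤ ∑' j, A * 2 ^ p * (2 ^ (p - q)) ^ j :=
        (summable_sum fun k _ => hsum k).tsum_le_tsum hcol
          ((summable_geometric_of_lt_one (by positivity) hρ).mul_left _)
    _ = _ := by rw [tsum_mul_left, tsum_geometric_of_lt_one (by positivity) hρ, mul_assoc]

variable [IsProbabilityMeasure ν]

lemma summable_lqSum (hν : ∀ᵐ x ∂ν, ∀ i, x i ∈ Set.Ioc (0 : ℝ) 1) {r q : ℝ} (hq : 0 < q)
    (hq1 : q ≤ 1) (h : lqSpectrum ν q < r * q) :
    Summable fun n : ℕ => ((2 ^ (-(n : ℤ)) : ℝ) ^ r) ^ q * lqSum ν n q := by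
  obtain ⟨s, hs1, hs2⟩ := exists_between h
  have hρ : (2 : ℝ) ^ (s - r * q) < 1 := Real.rpow_lt_one_of_one_lt_of_neg one_lt_two (by linarith)
  refine (summable_geometric_of_lt_one (by positivity) hρ).of_norm_bounded_eventually_nat ?_
  filter_upwards [eventually_lt_of_limsup_lt hs1 (isBoundedUnder_le_lqSpectrumN hν hq hq1),
    eventually_gt_atTop 0] with n hn hn0
  have hl := zero_lt_one.trans_le (one_le_lqSum hν n hq hq1)
  rw [Real.norm_of_nonneg (by positivity)]
  calc _ ≤ ((2 ^ (-(n : ℤ)) : ℝ) ^ r) ^ q * (2 : ℝ) ^ (s * n) := by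
        gcongr
        exact lqSum_le_of_lqSpectrumN_le hν hn0 hq hq1 hn.le
    _ = _ := by
        rw [← Real.rpow_intCast, ← Real.rpow_mul two_pos.le, ← Real.rpow_mul two_pos.le,
          ← Real.rpow_add two_pos, ← Real.rpow_mul_natCast two_pos.le]
        congr 1
        push_cast
        ring

lemma exists_quantError_le (hν : ∀ᵐ x ∂ν, ∀ i, x i ∈ Set.Ioc (0 : ℝ) 1) {r q : ℝ} (hr : 0 < r)
    (hq : 0 < q) (hq1 : q ≤ 1) (h : lqSpectrum ν q < r * q) :
    ∃ C > 0, ∀ᶠ m : ℕ in atTop, quantError ν m r ≤ C * (m : ℝ) ^ (-((1 - q) / (q * r))) := by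
  have hsum := summable_lqSum hν hq hq1 h
  have hl : ∀ n, 0 < lqSum ν n q := fun n => zero_lt_one.trans_le (one_le_lqSum hν n hq hq1)
  have hnonneg : ∀ n : ℕ, 0 ≤ ((2 ^ (-(n : ℤ)) : ℝ) ^ r) ^ q * lqSum ν n q := fun n =>
    mul_nonneg (by positivity) (hl n).le
  obtain ⟨K, hK⟩ : ∃ K, K = ∑' n : ℕ, ((2 ^ (-(n : ℤ)) : ℝ) ^ r) ^ q * lqSum ν n q := ⟨_, rfl⟩
  have hK0 : 0 < K := by
    rw [hK]
    exact hsum.tsum_pos hnonneg 0 (by simpa using hl 0)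
  obtain ⟨B, hB⟩ : ∃ B : ℝ, B = 2 ^ d * ((d + 1) ^ r * 2 ^ r) := ⟨_, rfl⟩
  have hB0 : 0 < B := by rw [hB]; positivity
  refine ⟨(B * K ^ (1 / q)) ^ (1 / r), by positivity, ?_⟩
  filter_upwards [eventually_gt_atTop 0, eventually_ge_atTop ⌈K⌉₊] with m hm hmK
  have hm0 : (0 : ℝ) < m := Nat.cast_pos.2 hm
  have hmK' : K ≤ m := (Nat.le_ceil K).trans (Nat.cast_le.2 hmK)
  have ht : (0 : ℝ) < (K / m) ^ (1 / q) := by positivity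
  have ht1 : (K / m) ^ (1 / q) ≤ 1 :=
    Real.rpow_le_one (by positivity) ((div_le_one hm0).2 hmK') (by positivity)
  have htq : ((K / m) ^ (1 / q)) ^ (-q) = m / K := by
    rw [← Real.rpow_mul (by positivity), show 1 / q * -q = -1 by field_simp, Real.rpow_neg_one,
      inv_div]
  obtain ⟨α, hα, hαm, hint⟩ := exists_integral_infDist_rpow_le hν hr ht ht1 (N := m) fun L => by
    calc _ ≤ ∑ n ∈ Finset.range L, (m / K) * (((2 ^ (-(n : ℤ)) : ℝ) ^ r) ^ q * lqSum ν n q) := by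
          refine Finset.sum_le_sum fun n _ => ?_
          rw [← htq]
          exact card_heavyIndices_le hν ht hq n
      _ ≤ (m / K) * K := by
          rw [← Finset.mul_sum]
          gcongr
          rw [hK]
          exact hsum.sum_le_tsum _ fun n _ => hnonneg n
      _ = m := by field_simp
  refine (quantError_le hα (by exact_mod_cast hαm)).trans ?_
  calc _ ≤ (m * (2 ^ d * ((d + 1) ^ r * 2 ^ r * (K / m) ^ (1 / q)))) ^ (1 / r) :=
        Real.rpow_le_rpow (integral_infDist_rpow_nonneg _ r) hint (by positivity)
    _ = ((B * K ^ (1 / q)) * (m : ℝ) ^ (1 - 1 / q)) ^ (1 / r) := by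
        rw [hB, Real.div_rpow hK0.le hm0.le, Real.rpow_sub hm0, Real.rpow_one]
        congr 1
        ring
    _ = _ := by
        rw [Real.mul_rpow (by positivity) (by positivity), ← Real.rpow_mul hm0.le]
        congr 2
        field_simp
        ring

lemma upperQDim_le (hν : ∀ᵐ x ∂ν, ∀ i, x i ∈ Set.Ioc (0 : ℝ) 1) {r q : ℝ} (hr : 0 < r)
    (hq : 0 < q) (hq1 : q < 1) (h : lqSpectrum ν q < r * q) :
    upperQDim ν r ≤ r * q / (1 - q) := by
  obtain ⟨C, hC, hC'⟩ := exists_quantError_le hν hr hq hq1.le h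
  have := upperQDim_le_one_div (div_pos (sub_pos.2 hq1) (mul_pos hq hr)) hC hC'
  rwa [one_div_div, mul_comm q r] at this

lemma exists_card_le (hν : ∀ᵐ x ∂ν, ∀ i, x i ∈ Set.Ioc (0 : ℝ) 1) {r D : ℝ} (hr : 0 < r)
    (hD : 0 < D) (h : ∀ᶠ n : ℕ in atTop, quantError ν n r ≤ (n : ℝ) ^ (-(1 / D))) :
    ∃ K > 0, ∀ (n : ℕ) (c : ℝ), 0 < c → c ≤ 1 → ∀ S : Finset (Fin d → ℤ),
      (∀ k ∈ S, c ≤ ν.real (dyadicCube d n k)) →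
      (S.card : ℝ) ≤ K * (c * (2 ^ (-(n : ℤ))) ^ r) ^ (-(D / (D + r))) := by
  obtain ⟨m₀, hm₀⟩ := eventually_atTop.1 h
  refine ⟨(3 ^ d + 1) * (m₀ + 2), by positivity, fun n c hc hc1 S hS => ?_⟩
  set δ : ℝ := 2 ^ (-(n : ℤ)) with hδ
  have hδ0 : 0 < δ := by positivity
  have hδ1 : δ ≤ 1 := by
    rw [hδ, zpow_neg, zpow_natCast]
    exact inv_le_one_of_one_le₀ (one_le_pow₀ one_le_two)
  have hJ : 0 < c * δ ^ r := by positivity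
  have hJ1 : c * δ ^ r ≤ 1 := mul_le_one₀ hc1 (by positivity) (Real.rpow_le_one hδ0.le hδ1 hr.le)
  have hX : 1 ≤ (c * δ ^ r) ^ (-(D / (D + r))) :=
    Real.one_le_rpow_of_pos_of_le_one_of_nonpos hJ hJ1 (neg_nonpos.2 (by positivity))
  obtain ⟨m, hm⟩ : ∃ m, m = S.card / (3 ^ d + 1) := ⟨_, rfl⟩
  have hcard : (S.card : ℝ) ≤ (3 ^ d + 1) * (m + 1) := by
    have : S.card < (3 ^ d + 1) * (m + 1) := by
      rw [hm]
      exact Nat.lt_mul_div_succ _ (by positivity)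
    exact_mod_cast this.le
  have hmX : (m : ℝ) ≤ m₀ + 1 ∨ (m : ℝ) ≤ (c * δ ^ r) ^ (-(D / (D + r))) := by
    rcases le_or_gt m (m₀ + 1) with hle | hlt
    · left
      exact_mod_cast hle
    · right
      have hm0 : 0 < m := by omega
      have hm0' : (0 : ℝ) < m := Nat.cast_pos.2 hm0
      have h1 : (m * (c * δ ^ r)) ^ (1 / r) ≤ (m : ℝ) ^ (-(1 / D)) := by
        refine (le_quantError hm0 fun α hα hαm => ?_).trans (hm₀ m (by omega))
        refine Real.rpow_le_rpow (by positivity) ?_ (by positivity)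
        exact mul_le_integral_infDist_rpow hν hr hc.le hS (by rw [hm]; exact Nat.div_mul_le_self _ _)
          hα hαm
      have h2 := Real.log_le_log (by positivity) h1
      rw [Real.log_rpow (by positivity), Real.log_rpow hm0', Real.log_mul hm0'.ne' hJ.ne'] at h2
      rw [← Real.log_le_log_iff hm0' (by positivity), Real.log_rpow hJ]
      field_simp at h2 ⊢
      linarith
  refine hcard.trans ?_
  rw [mul_assoc]
  gcongr
  have hm₀' : (0 : ℝ) ≤ m₀ := m₀.cast_nonneg
  rcases hmX with h1 | h1 <;> nlinarith

lemma lqSpectrum_le (hν : ∀ᵐ x ∂ν, ∀ i, x i ∈ Set.Ioc (0 : ℝ) 1) {r D q : ℝ} (hr : 0 < r)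
    (hD : 0 < D) (h : ∀ᶠ n : ℕ in atTop, quantError ν n r ≤ (n : ℝ) ^ (-(1 / D)))
    (hq : D / (D + r) < q) (hq1 : q ≤ 1) : lqSpectrum ν q ≤ r * (D / (D + r)) := by
  obtain ⟨K, hK, hcard⟩ := exists_card_le hν hr hD h
  have hp : 0 < D / (D + r) := by positivity
  set p := D / (D + r) with hp'
  have hρ : (2 : ℝ) ^ (p - q) < 1 := Real.rpow_lt_one_of_one_lt_of_neg one_lt_two (by linarith)
  have hρ' : 0 < (1 - (2 : ℝ) ^ (p - q))⁻¹ := inv_pos.2 (sub_pos.2 hρ)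
  refine lqSpectrum_le_of_lqSum_le hν (hp.trans hq) hq1
    (K := K * (2 ^ p * (1 - 2 ^ (p - q))⁻¹)) (by positivity) fun n => ?_
  rw [lqSum_eq_sum hν n (hp.trans hq).ne']
  refine (sum_rpow_le_of_card_filter_le (A := K * ((2 ^ (-(n : ℤ))) ^ r) ^ (-p)) hp hq
    (fun _ => measureReal_nonneg) (fun _ => measureReal_le_one) fun c hc hc1 S _ hS => ?_).trans
    (le_of_eq ?_)
  · refine (hcard n c hc hc1 S hS).trans (le_of_eq ?_)
    rw [Real.mul_rpow hc.le (by positivity)]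
    ring
  · have : ((2 ^ (-(n : ℤ)) : ℝ) ^ r) ^ (-p) = 2 ^ (r * p * n) := by
      rw [← Real.rpow_intCast, ← Real.rpow_mul two_pos.le, ← Real.rpow_mul two_pos.le]
      congr 1
      push_cast
      ring
    rw [this]
    ring

end Dimension

/-- If `D̄_r(ν) > 0` then with `q_r := D̄_r(ν)/(D̄_r(ν)+r)` one has
`β_ν(q_r) = r q_r`, i.e. the point `(q_r, β_ν(q_r))` is the intersection of the
graph of `β_ν` with the line of slope `r` through the origin. -/
theorem lqSpectrum_at_qr {d : ℕ} (ν : Measure (EuclideanSpace ℝ (Fin d)))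
    [IsProbabilityMeasure ν]
    (hsupp : ν ({x : EuclideanSpace ℝ (Fin d) | ∀ i, x i ∈ Set.Ioc (0 : ℝ) 1}ᶜ) = 0)
    (r : ℝ) (hr : 0 < r) (hpos : 0 < upperQDim ν r) :
    lqSpectrum ν (upperQDim ν r / (upperQDim ν r + r)) =
      r * (upperQDim ν r / (upperQDim ν r + r)) := by
  have hν : ∀ᵐ x ∂ν, ∀ i, x i ∈ Set.Ioc (0 : ℝ) 1 := hsupp
  obtain ⟨D, hD⟩ : ∃ D, D = upperQDim ν r := ⟨_, rfl⟩
  rw [← hD] at hpos ⊢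
  have hq₀ : D / (D + r) ∈ Set.Ioo (0 : ℝ) 1 :=
    ⟨by positivity, (div_lt_one (by positivity)).2 (by linarith)⟩
  set q₀ := D / (D + r) with hq₀D
  have hlt : ∀ q ∈ Set.Ioo 0 q₀, r * q ≤ lqSpectrum ν q := by
    intro q hq
    by_contra! h
    have hq1 : q < 1 := hq.2.trans hq₀.2
    have h1 := upperQDim_le hν hr hq.1 hq1 h
    have h2 := hq.2
    rw [← hD, le_div_iff₀ (sub_pos.2 hq1)] at h1
    rw [hq₀D, lt_div_iff₀ (by positivity)] at h2
    linarith
  have hgt : ∀ q ∈ Set.Ioo q₀ 1, lqSpectrum ν q ≤ r * q := by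
    intro q hq
    have hq1 : 0 < 1 - q := sub_pos.2 hq.2
    have h1 : D < r * q / (1 - q) := by
      have h2 := hq.1
      rw [hq₀D, div_lt_iff₀ (by positivity)] at h2
      rw [lt_div_iff₀ hq1]
      linarith
    obtain ⟨D', hD1, hD2⟩ := exists_between h1
    have hD0 : 0 < D' := hpos.trans hD1
    have hlt' : D' / (D' + r) < q := by
      rw [lt_div_iff₀ hq1] at hD2
      rw [div_lt_iff₀ (by positivity)]
      linarith
    have h3 := lqSpectrum_le hν hr hD0
      (eventually_quantError_le (by rwa [← hD]) (by rwa [← hD])) hlt' hq.2.le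
    exact h3.trans (by gcongr)
  have hcont : ContinuousAt (lqSpectrum ν) q₀ :=
    (continuousOn_lqSpectrum hν).continuousAt (isOpen_Ioo.mem_nhds hq₀)
  have hlin : ContinuousAt (fun q : ℝ => r * q) q₀ := by fun_prop
  refine le_antisymm ?_ ?_
  · exact le_of_tendsto_of_tendsto (hcont.mono_left nhdsWithin_le_nhds)
      (hlin.mono_left nhdsWithin_le_nhds)
      (mem_of_superset (Ioo_mem_nhdsGT hq₀.2) hgt)
  · exact le_of_tendsto_of_tendsto (hlin.mono_left nhdsWithin_le_nhds)
      (hcont.mono_left nhdsWithin_le_nhds)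
      (mem_of_superset (Ioo_mem_nhdsLT hq₀.1) hlt)
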